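/- (Proposition, part 2, first clause.) Let T : (Fin k → ℤ) →₀ M and S : (Fin k → ℤ) →₀ N be boost-weight decomposed tensors over a commutative ring R, let i ≤ k, and suppose T possesses the S_i-property and S possesses the N-property. Then for any R-bilinear map B : M → N → P, the product T·S possesses the S_i-property. -/

import Mathlib

/-- The product of two boost-weight decomposed tensors `T : (Fin k → ℤ) →₀ M` and
`S : (Fin k → ℤ) →₀ N` with respect to a bilinear map `B : M →ₗ N →ₗ P`, modeling the
tensor product: the component of boost weight `b` is `Σ_{b₁ + b₂ = b} B (T b₁) (S b₂)`. -/
noncomputable def boostProd {k : ℕ} {R M N P : Type*} [CommRing R]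
    [AddCommGroup M] [Module R M] [AddCommGroup N] [Module R N]
    [AddCommGroup P] [Module R P] (B : M →ₗ[R] N →ₗ[R] P)
    (T : (Fin k → ℤ) →₀ M) (S : (Fin k → ℤ) →₀ N) : (Fin k → ℤ) →₀ P :=
  T.sum fun b₁ m => S.sum fun b₂ n => Finsupp.single (b₁ + b₂) (B m n)

/-- Restricting a lexicographically negative vector to its first `i` coordinates gives a
lexicographically nonpositive vector. -/
theorem toLex_comp_castLE_nonpos {k i : ℕ} (hik : i ≤ k) {b : Fin k → ℤ}
    (hb : toLex b < toLex 0) : toLex (b ∘ Fin.castLE hik) ≤ toLex 0 := by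
  obtain ⟨j, hj, hlt⟩ := hb
  by_cases hji : j.val < i
  · refine le_of_lt ⟨⟨j, hji⟩, fun l hl => hj (Fin.castLE hik l) hl, hlt⟩
  · refine le_of_eq (congrArg toLex (funext fun l => hj (Fin.castLE hik l) ?_))
    exact Fin.lt_def.mpr (l.isLt.trans_le (Nat.le_of_not_lt hji))

/-- Every weight in the support of a product is a sum of weights in the supports of the
factors. -/
theorem exists_add_eq_of_mem_support_boostProd {k : ℕ} {R M N P : Type*} [CommRing R]
    [AddCommGroup M] [Module R M] [AddCommGroup N] [Module R N]
    [AddCommGroup P] [Module R P] (B : M →ₗ[R] N →ₗ[R] P)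
    {T : (Fin k → ℤ) →₀ M} {S : (Fin k → ℤ) →₀ N} {b : Fin k → ℤ}
    (hb : b ∈ (boostProd B T S).support) :
    ∃ b₁ ∈ T.support, ∃ b₂ ∈ S.support, b₁ + b₂ = b := by
  classical
  obtain ⟨b₁, h₁, hb⟩ := Finset.mem_biUnion.mp (Finsupp.support_sum hb)
  obtain ⟨b₂, h₂, hb⟩ := Finset.mem_biUnion.mp (Finsupp.support_sum hb)
  exact ⟨b₁, h₁, b₂, h₂, (Finset.mem_singleton.mp (Finsupp.support_single_subset hb)).symm⟩

/-- Proposition, part 2, first clause: if `T` possesses the `S_i`-property and `S` the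
`N`-property, then the product `T·S` (modeling `T ⊗ S`) possesses the `S_i`-property. -/
theorem boostProd_sProp_of_sProp_nProp {k : ℕ} {R M N P : Type*} [CommRing R]
    [AddCommGroup M] [Module R M] [AddCommGroup N] [Module R N]
    [AddCommGroup P] [Module R P] (B : M →ₗ[R] N →ₗ[R] P)
    (T : (Fin k → ℤ) →₀ M) (S : (Fin k → ℤ) →₀ N)
    {i : ℕ} (hik : i ≤ k)
    (hT : ∀ b ∈ T.support, toLex (b ∘ Fin.castLE hik) ≤ toLex 0)
    (hS : ∀ b ∈ S.support, toLex b < toLex 0) :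
    ∀ b ∈ (boostProd B T S).support, toLex (b ∘ Fin.castLE hik) ≤ toLex 0 := by
  intro b hb
  obtain ⟨b₁, h₁, b₂, h₂, rfl⟩ := exists_add_eq_of_mem_support_boostProd B hb
  exact add_nonpos (hT b₁ h₁) (toLex_comp_castLE_nonpos hik (hS b₂ h₂))
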